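/- For every n ∈ ℤ∖{0} and each i ∈ {1,2,3}, the operator 𝒦_{n,i} is a compact operator on 𝒞^δ_0: for every sequence (f_k) in 𝒞^δ_0 with ‖f_k‖_{𝒞^δ} ≤ 1 for all k, there is a subsequence (f_{k_j}) such that (𝒦_{n,i}f_{k_j}) converges in the ‖·‖_{𝒞^δ} norm to an element of 𝒞^δ_0. -/

import Mathlib

open Filter Topology Set MeasureTheory intervalIntegral

/-- sup norm over `[0,∞)`. -/
noncomputable def supN (f : ℝ → ℂ) : ℝ := ⨆ β : Ici (0 : ℝ), ‖f (β : ℝ)‖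

/-- weighted seminorm `sup_{β>0} β^δ ‖f(β) − L‖`. -/
noncomputable def hoel (δ : ℝ) (f : ℝ → ℂ) (L : ℂ) : ℝ :=
  ⨆ β : Ioi (0 : ℝ), (β : ℝ) ^ δ * ‖f (β : ℝ) - L‖

/-- the `𝒞^δ` norm, with `L = f(∞)`. -/
noncomputable def normC (δ : ℝ) (f : ℝ → ℂ) (L : ℂ) : ℝ := supN f + hoel δ f L

/-- membership in `𝒞^δ`, with limit value `L` at infinity. -/
def MemCdelta (δ : ℝ) (f : ℝ → ℂ) (L : ℂ) : Prop :=
  ContinuousOn f (Ici 0) ∧ Tendsto f atTop (nhds L) ∧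
    BddAbove (Set.range fun β : Ioi (0 : ℝ) => (β : ℝ) ^ δ * ‖f (β : ℝ) - L‖)

/-- `a_n(β) = √(n²μ² − (2μ−1)η(β))`. -/
noncomputable def aFun (μ : ℝ) (η : ℝ → ℝ) (n : ℤ) (β : ℝ) : ℝ :=
  Real.sqrt ((n : ℝ) ^ 2 * μ ^ 2 - (2 * μ - 1) * η β)

/-- `χ_n(β) = η(β) − βη'(β)/(2a_n(β))`. -/
noncomputable def chiFun (μ : ℝ) (η : ℝ → ℝ) (n : ℤ) (β : ℝ) : ℝ :=
  η β - β * deriv η β / (2 * aFun μ η n β)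

/-- `W_n(β) = exp(∫_1^β a_n(b)/b db)`. -/
noncomputable def WFun (μ : ℝ) (η : ℝ → ℝ) (n : ℤ) (β : ℝ) : ℝ :=
  Real.exp (∫ b in (1 : ℝ)..β, aFun μ η n b / b)

/-- `L_{n,-}^{-1}`. -/
noncomputable def Lminus (μ : ℝ) (η : ℝ → ℝ) (n : ℤ) (f : ℝ → ℂ) (β : ℝ) : ℂ :=
  if 2 ≤ |n| then
    -(((β ^ (2 * μ - 1) / WFun μ η n β : ℝ) : ℂ) *
      ∫ b in (0 : ℝ)..β, ((b ^ (-(2 * μ)) * WFun μ η n b : ℝ) : ℂ) *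
        Complex.exp (Complex.I * (n : ℂ) * ((β : ℂ) - (b : ℂ))) * f b)
  else
    ((β ^ (2 * μ - 1) / WFun μ η n β : ℝ) : ℂ) *
      ∫ b in Ioi β, ((b ^ (-(2 * μ)) * WFun μ η n b : ℝ) : ℂ) *
        Complex.exp (Complex.I * (n : ℂ) * ((β : ℂ) - (b : ℂ))) * f b

/-- the averaging operator `(D_β+1)^{-1} f (β) = β^{-1} ∫_0^β f(b) db`. -/
noncomputable def Avg (f : ℝ → ℂ) (β : ℝ) : ℂ :=
  if β = 0 then f 0 else ((β⁻¹ : ℝ) : ℂ) * ∫ b in (0 : ℝ)..β, f b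

/-- `T_n f (β) = in ∫_0^β L_{n,-}^{-1} f (b) db`. -/
noncomputable def Tn (μ : ℝ) (η : ℝ → ℝ) (n : ℤ) (f : ℝ → ℂ) (β : ℝ) : ℂ :=
  Complex.I * (n : ℂ) * ∫ b in (0 : ℝ)..β, Lminus μ η n f b

/-- `𝒦_{n,1} f = χ_n · (D_β+1)^{-1} L_{n,-}^{-1} f`. -/
noncomputable def K1 (μ : ℝ) (η : ℝ → ℝ) (n : ℤ) (f : ℝ → ℂ) (β : ℝ) : ℂ :=
  ((chiFun μ η n β : ℝ) : ℂ) * Avg (Lminus μ η n f) β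

/-- `𝒦_{n,2} f = (βχ_n') · (D_β+1)^{-1} L_{n,-}^{-1} f`. -/
noncomputable def K2 (μ : ℝ) (η : ℝ → ℝ) (n : ℤ) (f : ℝ → ℂ) (β : ℝ) : ℂ :=
  ((β * deriv (chiFun μ η n) β : ℝ) : ℂ) * Avg (Lminus μ η n f) β

/-- `𝒦_{n,3} f = (1−χ_n) · T_n f`. -/
noncomputable def K3 (μ : ℝ) (η : ℝ → ℝ) (n : ℤ) (f : ℝ → ℂ) (β : ℝ) : ℂ :=
  ((1 - chiFun μ η n β : ℝ) : ℂ) * Tn μ η n f β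


/-- the three perturbation operators `𝒦_{n,1}, 𝒦_{n,2}, 𝒦_{n,3}`. -/
noncomputable def Kop (μ : ℝ) (η : ℝ → ℝ) (n : ℤ) (i : Fin 3) (f : ℝ → ℂ) (β : ℝ) : ℂ :=
  match i with
  | 0 => K1 μ η n f β
  | 1 => K2 μ η n f β
  | 2 => K3 μ η n f β

/-- A sequence of uniformly bounded, uniformly Lipschitz functions on the line has a subsequence
converging uniformly on compact sets. -/
theorem exists_subseq_tendsto_of_lipschitzWith {C : NNReal} {B : ℝ} (h : ℕ → C(ℝ, ℂ))
    (hL : ∀ k, LipschitzWith C (h k)) (hB : ∀ k x, ‖h k x‖ ≤ B) :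
    ∃ h₀ : C(ℝ, ℂ), (∀ x, ‖h₀ x‖ ≤ B) ∧
      ∃ φ : ℕ → ℕ, StrictMono φ ∧ Tendsto (h ∘ φ) atTop (𝓝 h₀) := by
  let S : Set C(ℝ, ℂ) := {u | LipschitzWith C u ∧ ∀ x, ‖u x‖ ≤ B}
  have himage : ContinuousMap.toFun '' S =
      {u : ℝ → ℂ | LipschitzWith C u} ∩ univ.pi fun _ => Metric.closedBall (0 : ℂ) B := by
    ext u
    constructor
    · rintro ⟨v, ⟨hv, hvB⟩, rfl⟩
      exact ⟨hv, fun x _ => by simpa using hvB x⟩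
    · rintro ⟨hu, huB⟩
      exact ⟨⟨u, hu.continuous⟩, ⟨hu, fun x => by simpa using huB x (mem_univ x)⟩, rfl⟩
  have hclosed : IsClosed {u : ℝ → ℂ | LipschitzWith C u} := by
    simp only [lipschitzWith_iff_dist_le_mul, ofPred_forall]
    exact isClosed_iInter fun x => isClosed_iInter fun y =>
      isClosed_le ((continuous_apply x).dist (continuous_apply y)) continuous_const
  have hS : IsCompact S := by
    refine ArzelaAscoli.isCompact_of_equicontinuous S ?_ ?_
    · rw [himage]
      exact (isCompact_univ_pi fun _ => isCompact_closedBall _ _).inter_left hclosed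
    · exact (LipschitzWith.uniformEquicontinuous _ C fun u : S => u.2.1).equicontinuous
  let _ := TopologicalSpace.pseudoMetrizableSpacePseudoMetric C(ℝ, ℂ)
  obtain ⟨h₀, hh₀, φ, hφ, hlim⟩ := hS.isSeqCompact fun k => ⟨hL k, hB k⟩
  exact ⟨h₀, hh₀.2, φ, hφ, hlim⟩

/-- If a nonnegative `v` on `(0,∞)` grows at least like a power `c > 0`, then
`∫_0^β v(b)/b db ≤ v(β)/c`. -/
theorem integrableOn_Ioc_div_of_growth {v v' : ℝ → ℝ} {c β : ℝ} (hc : 0 < c) (hβ : 0 < β)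
    (hv : ∀ b > 0, 0 ≤ v b) (hd : ∀ b > 0, HasDerivAt v (v' b) b)
    (hv' : ContinuousOn v' (Ioi 0)) (hle : ∀ b > 0, c * (v b / b) ≤ v' b) :
    IntegrableOn (fun b => v b / b) (Ioc 0 β) ∧ ∫ b in (0 : ℝ)..β, v b / b ≤ v β / c := by
  have hcont : ContinuousOn (fun b => v b / b) (Ioi 0) :=
    ContinuousOn.div (fun b hb => (hd b hb).continuousAt.continuousWithinAt) continuousOn_id
      fun b hb => (mem_Ioi.1 hb).ne'
  have hsub : ∀ ε > 0, ε ≤ β → uIcc ε β ⊆ Ioi 0 := fun ε hε hεβ b hb => by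
    rw [uIcc_of_le hεβ] at hb
    exact hε.trans_le hb.1
  have hbound : ∀ ε > 0, ε ≤ β → ∫ b in ε..β, v b / b ≤ v β / c := by
    intro ε hε hεβ
    have hi := (hcont.mono (hsub ε hε hεβ)).intervalIntegrable (μ := volume)
    have hi' := (hv'.mono (hsub ε hε hεβ)).intervalIntegrable (μ := volume)
    have h1 : ∫ b in ε..β, c * (v b / b) ≤ ∫ b in ε..β, v' b :=
      intervalIntegral.integral_mono_on hεβ (hi.const_mul c) hi'
        fun b hb => hle b (hε.trans_le hb.1)
    rw [intervalIntegral.integral_const_mul, intervalIntegral.integral_eq_sub_of_hasDerivAt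
      (fun b hb => hd b (hsub ε hε hεβ hb)) hi'] at h1
    rw [le_div_iff₀ hc]
    linarith [hv ε hε]
  let u : ℕ → ℝ := fun k => β / (k + 1)
  have hu0 : ∀ k, 0 < u k := fun k => by positivity
  have hub : ∀ k, u k ≤ β := fun k => div_le_self hβ.le (by simp)
  have hu : Tendsto u atTop (𝓝 0) := by
    simpa [u, Function.comp_def] using
      (tendsto_const_div_atTop_nhds_zero_nat β).comp (tendsto_add_atTop_nat 1)
  have hint : IntegrableOn (fun b => v b / b) (Ioc 0 β) := by
    refine integrableOn_Ioc_of_intervalIntegral_norm_bounded_left (I := v β / c)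
      (fun k => ((hcont.mono (hsub (u k) (hu0 k) (hub k))).intervalIntegrable).1) hu
      (Eventually.of_forall fun k => ?_)
    rw [setIntegral_congr_fun (g := fun b => v b / b) measurableSet_Ioc,
      ← intervalIntegral.integral_of_le (hub k)]
    · exact hbound _ (hu0 k) (hub k)
    · intro b hb
      have hb0 := (hu0 k).trans hb.1
      exact Real.norm_of_nonneg (div_nonneg (hv b hb0) hb0.le)
  refine ⟨hint, ?_⟩
  have hlim : Tendsto (fun k => ∫ b in u k..β, v b / b) atTop (𝓝 (∫ b in (0 : ℝ)..β, v b / b)) := by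
    have hcl := intervalIntegral.continuousOn_primitive_interval_left (a := 0) (b := β)
      (f := fun b => v b / b) (μ := volume)
      (by rw [uIcc_of_le hβ.le, integrableOn_Icc_iff_integrableOn_Ioc]; exact hint)
    refine (hcl 0 left_mem_uIcc).tendsto.comp (tendsto_nhdsWithin_iff.2 ⟨hu, ?_⟩)
    exact Eventually.of_forall fun k => by
      rw [uIcc_of_le hβ.le]; exact ⟨(hu0 k).le, hub k⟩
  exact le_of_tendsto hlim (Eventually.of_forall fun k => hbound _ (hu0 k) (hub k))

/-- If a nonnegative `v` on `(0,∞)` decays at least like a power `-c < 0`, then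
`∫_β^∞ v(b)/b db ≤ v(β)/c`. -/
theorem integrableOn_Ioi_div_of_decay {v v' : ℝ → ℝ} {c β : ℝ} (hc : 0 < c) (hβ : 0 < β)
    (hv : ∀ b > 0, 0 ≤ v b) (hd : ∀ b > 0, HasDerivAt v (v' b) b)
    (hv' : ContinuousOn v' (Ioi 0)) (hle : ∀ b > 0, v' b ≤ -(c * (v b / b))) :
    IntegrableOn (fun b => v b / b) (Ioi β) ∧ ∫ b in Ioi β, v b / b ≤ v β / c := by
  have hcont : ContinuousOn (fun b => v b / b) (Ioi 0) :=
    ContinuousOn.div (fun b hb => (hd b hb).continuousAt.continuousWithinAt) continuousOn_id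
      fun b hb => (mem_Ioi.1 hb).ne'
  have hsub : ∀ R, β ≤ R → uIcc β R ⊆ Ioi 0 := fun R hR b hb => by
    rw [uIcc_of_le hR] at hb
    exact hβ.trans_le hb.1
  have hbound : ∀ R, β ≤ R → ∫ b in β..R, v b / b ≤ v β / c := by
    intro R hR
    have hi := (hcont.mono (hsub R hR)).intervalIntegrable (μ := volume)
    have hi' := (hv'.mono (hsub R hR)).intervalIntegrable (μ := volume)
    have h1 : ∫ b in β..R, v' b ≤ ∫ b in β..R, -(c * (v b / b)) :=
      intervalIntegral.integral_mono_on hR hi' (hi.const_mul c).neg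
        fun b hb => hle b (hβ.trans_le hb.1)
    rw [intervalIntegral.integral_neg, intervalIntegral.integral_const_mul,
      intervalIntegral.integral_eq_sub_of_hasDerivAt (fun b hb => hd b (hsub R hR hb)) hi'] at h1
    rw [le_div_iff₀ hc]
    linarith [hv R (hβ.trans_le hR)]
  have hint : IntegrableOn (fun b => v b / b) (Ioi β) := by
    refine integrableOn_Ioi_of_intervalIntegral_norm_bounded (v β / c) β
      (b := fun k : ℕ => β + k)
      (fun k => ((hcont.mono (hsub (β + k) (by simp))).intervalIntegrable).1)
      (tendsto_atTop_add_const_left _ _ tendsto_natCast_atTop_atTop)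
      (Eventually.of_forall fun k => ?_)
    rw [intervalIntegral.integral_congr (g := fun b => v b / b)]
    · exact hbound _ (by simp)
    · intro b hb
      have hb0 : 0 < b := hsub (β + k) (by simp) hb
      exact Real.norm_of_nonneg (div_nonneg (hv b hb0) hb0.le)
  exact ⟨hint, le_of_tendsto (intervalIntegral_tendsto_integral_Ioi β hint tendsto_id)
    ((eventually_ge_atTop β).mono fun R hR => hbound R hR)⟩

section Kernel

variable {μ : ℝ} {η : ℝ → ℝ} {n : ℤ}

theorem continuous_aFun (hη : Continuous η) : Continuous (aFun μ η n) := by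
  unfold aFun
  fun_prop

theorem WFun_pos (β : ℝ) : 0 < WFun μ η n β := Real.exp_pos _

theorem hasDerivAt_WFun (hη : Continuous η) {β : ℝ} (hβ : 0 < β) :
    HasDerivAt (WFun μ η n) (WFun μ η n β * (aFun μ η n β / β)) β := by
  have hcont : ContinuousOn (fun b => aFun μ η n b / b) (Ioi 0) :=
    (continuous_aFun hη).continuousOn.div continuousOn_id fun b hb => (mem_Ioi.1 hb).ne'
  have hsub : uIcc 1 β ⊆ Ioi (0 : ℝ) := fun b hb => (lt_min one_pos hβ).trans_le hb.1
  exact (intervalIntegral.integral_hasDerivAt_right (hcont.mono hsub).intervalIntegrable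
    (hcont.stronglyMeasurableAtFilter isOpen_Ioi β hβ)
    (hcont.continuousAt (Ioi_mem_nhds hβ))).exp

theorem hasDerivAt_rpow_mul_WFun (hη : Continuous η) (r : ℝ) {β : ℝ} (hβ : 0 < β) :
    HasDerivAt (fun b => b ^ r * WFun μ η n b)
      (β ^ r * WFun μ η n β * (aFun μ η n β + r) / β) β := by
  refine ((Real.hasDerivAt_rpow_const (p := r) (Or.inl hβ.ne')).mul
    (hasDerivAt_WFun (μ := μ) (n := n) hη hβ)).congr_deriv ?_
  rw [Real.rpow_sub_one hβ.ne']
  field_simp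
  ring

theorem continuousOn_WFun (hη : Continuous η) : ContinuousOn (WFun μ η n) (Ioi 0) :=
  fun _ hb => (hasDerivAt_WFun hη hb).continuousAt.continuousWithinAt

theorem continuousOn_rpow_mul_WFun (hη : Continuous η) (r : ℝ) :
    ContinuousOn (fun b => b ^ r * WFun μ η n b) (Ioi 0) :=
  fun _ hb => (hasDerivAt_rpow_mul_WFun hη r hb).continuousAt.continuousWithinAt

theorem continuousOn_deriv_rpow_mul_WFun (hη : Continuous η) (r : ℝ) :
    ContinuousOn (fun b => b ^ r * WFun μ η n b * (aFun μ η n b + r) / b) (Ioi 0) :=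
  ((continuousOn_rpow_mul_WFun hη r).mul
    ((continuous_aFun hη).add continuous_const).continuousOn).div continuousOn_id
    fun _ hb => (mem_Ioi.1 hb).ne'

theorem weight_eq (s : ℝ) {b : ℝ} (hb : 0 < b) :
    b ^ (-(2 * μ)) * WFun μ η n b * b ^ (-s) = b ^ (1 - 2 * μ - s) * WFun μ η n b / b := by
  rw [show (1 - 2 * μ - s) = -(2 * μ) + -s + 1 by ring, Real.rpow_add_one hb.ne',
    Real.rpow_add hb]
  field_simp

/-- The weight of the kernel of `Lminus` against `b ^ (-s)`, integrated from the origin. -/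
theorem integral_weight_Ioc (hη : Continuous η) {s c β : ℝ} (hc : 0 < c) (hβ : 0 < β)
    (ha : ∀ b > 0, c ≤ aFun μ η n b + (1 - 2 * μ - s)) :
    IntegrableOn (fun b => b ^ (-(2 * μ)) * WFun μ η n b * b ^ (-s)) (Ioc 0 β) ∧
      ∫ b in (0 : ℝ)..β, b ^ (-(2 * μ)) * WFun μ η n b * b ^ (-s) ≤
        β ^ (1 - 2 * μ - s) * WFun μ η n β / c := by
  have key := integrableOn_Ioc_div_of_growth hc hβ
    (v := fun b => b ^ (1 - 2 * μ - s) * WFun μ η n b)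
    (fun b hb => mul_nonneg (Real.rpow_nonneg (le_of_lt hb) _) (WFun_pos b).le)
    (fun b hb => hasDerivAt_rpow_mul_WFun hη _ hb) (continuousOn_deriv_rpow_mul_WFun hη _) ?_
  · rw [intervalIntegral.integral_of_le hβ.le] at key ⊢
    rw [setIntegral_congr_fun measurableSet_Ioc fun b hb => weight_eq s hb.1]
    exact ⟨key.1.congr_fun (fun b hb => (weight_eq s hb.1).symm) measurableSet_Ioc, key.2⟩
  · intro b hb
    have h0 : 0 ≤ b ^ (1 - 2 * μ - s) * WFun μ η n b / b :=
      div_nonneg (mul_nonneg (Real.rpow_nonneg (le_of_lt hb) _) (WFun_pos b).le) (le_of_lt hb)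
    calc _ ≤ (aFun μ η n b + (1 - 2 * μ - s)) * (b ^ (1 - 2 * μ - s) * WFun μ η n b / b) :=
          mul_le_mul_of_nonneg_right (ha b hb) h0
      _ = _ := by ring

/-- The weight of the kernel of `Lminus` against `b ^ (-s)`, integrated to infinity. -/
theorem integral_weight_Ioi (hη : Continuous η) {s c β : ℝ} (hc : 0 < c) (hβ : 0 < β)
    (ha : ∀ b > 0, aFun μ η n b + (1 - 2 * μ - s) ≤ -c) :
    IntegrableOn (fun b => b ^ (-(2 * μ)) * WFun μ η n b * b ^ (-s)) (Ioi β) ∧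
      ∫ b in Ioi β, b ^ (-(2 * μ)) * WFun μ η n b * b ^ (-s) ≤
        β ^ (1 - 2 * μ - s) * WFun μ η n β / c := by
  have key := integrableOn_Ioi_div_of_decay hc hβ
    (v := fun b => b ^ (1 - 2 * μ - s) * WFun μ η n b)
    (fun b hb => mul_nonneg (Real.rpow_nonneg (le_of_lt hb) _) (WFun_pos b).le)
    (fun b hb => hasDerivAt_rpow_mul_WFun hη _ hb) (continuousOn_deriv_rpow_mul_WFun hη _) ?_
  · rw [setIntegral_congr_fun measurableSet_Ioi fun b hb => weight_eq s (hβ.trans hb)]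
    exact ⟨key.1.congr_fun (fun b hb => (weight_eq s (hβ.trans hb)).symm) measurableSet_Ioi, key.2⟩
  · intro b hb
    have h0 : 0 ≤ b ^ (1 - 2 * μ - s) * WFun μ η n b / b :=
      div_nonneg (mul_nonneg (Real.rpow_nonneg (le_of_lt hb) _) (WFun_pos b).le) (le_of_lt hb)
    calc _ = (aFun μ η n b + (1 - 2 * μ - s)) * (b ^ (1 - 2 * μ - s) * WFun μ η n b / b) := by ring
      _ ≤ -c * (b ^ (1 - 2 * μ - s) * WFun μ η n b / b) :=
          mul_le_mul_of_nonneg_right (ha b hb) h0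
      _ = _ := by ring

theorem norm_exp_I_mul_int_mul (n : ℤ) (x : ℝ) :
    ‖Complex.exp (Complex.I * (n : ℂ) * (x : ℂ))‖ = 1 := by
  rw [show Complex.I * (n : ℂ) * (x : ℂ) = ((n * x : ℝ) : ℂ) * Complex.I by push_cast; ring]
  exact Complex.norm_exp_ofReal_mul_I _

theorem norm_kernel_le {f : ℝ → ℂ} {s b : ℝ} (β : ℝ) (hb : 0 < b) (hf : ‖f b‖ ≤ b ^ (-s)) :
    ‖((b ^ (-(2 * μ)) * WFun μ η n b : ℝ) : ℂ) *
        Complex.exp (Complex.I * (n : ℂ) * ((β : ℂ) - (b : ℂ))) * f b‖ ≤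
      b ^ (-(2 * μ)) * WFun μ η n b * b ^ (-s) := by
  have h0 : 0 ≤ b ^ (-(2 * μ)) * WFun μ η n b :=
    mul_nonneg (Real.rpow_nonneg hb.le _) (WFun_pos b).le
  rw [← Complex.ofReal_sub, norm_mul, norm_mul, norm_exp_I_mul_int_mul, mul_one,
    Complex.norm_real, Real.norm_of_nonneg h0]
  exact mul_le_mul_of_nonneg_left hf h0

/-- Pointwise bound for `Lminus` on functions dominated by `b ^ (-s)`. -/
theorem norm_Lminus_le (hη : Continuous η) {f : ℝ → ℂ} {s c β : ℝ} (hc : 0 < c) (hβ : 0 < β)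
    (hf : ∀ b > 0, ‖f b‖ ≤ b ^ (-s))
    (h2 : 2 ≤ |n| → ∀ b > 0, c ≤ aFun μ η n b + (1 - 2 * μ - s))
    (h1 : ¬ 2 ≤ |n| → ∀ b > 0, aFun μ η n b + (1 - 2 * μ - s) ≤ -c) :
    ‖Lminus μ η n f β‖ ≤ β ^ (-s) / c := by
  have hW := WFun_pos (μ := μ) (η := η) (n := n) β
  have h0 : 0 ≤ β ^ (2 * μ - 1) / WFun μ η n β := div_nonneg (Real.rpow_nonneg hβ.le _) hW.le
  have hfin : β ^ (2 * μ - 1) / WFun μ η n β * (β ^ (1 - 2 * μ - s) * WFun μ η n β / c) =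
      β ^ (-s) / c := by
    rw [show -s = (2 * μ - 1) + (1 - 2 * μ - s) by ring, Real.rpow_add hβ]
    field_simp
  rw [← hfin]
  unfold Lminus
  split_ifs with hn
  · rw [norm_neg, norm_mul, Complex.norm_real, Real.norm_of_nonneg h0]
    refine mul_le_mul_of_nonneg_left ?_ h0
    obtain ⟨hi, hle⟩ := integral_weight_Ioc hη hc hβ (h2 hn)
    refine le_trans ?_ hle
    rw [intervalIntegral.integral_of_le hβ.le, intervalIntegral.integral_of_le hβ.le]
    refine norm_integral_le_of_norm_le hi ?_
    filter_upwards [ae_restrict_mem measurableSet_Ioc] with b hb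
    exact norm_kernel_le β hb.1 (hf b hb.1)
  · rw [norm_mul, Complex.norm_real, Real.norm_of_nonneg h0]
    refine mul_le_mul_of_nonneg_left ?_ h0
    obtain ⟨hi, hle⟩ := integral_weight_Ioi hη hc hβ (h1 hn)
    refine le_trans ?_ hle
    refine norm_integral_le_of_norm_le hi ?_
    filter_upwards [ae_restrict_mem measurableSet_Ioi] with b hb
    exact norm_kernel_le β (hβ.trans hb) (hf b (hβ.trans hb))

/-- The integrand of `Lminus` with the phase in the outer variable factored out. -/
noncomputable def kernelIntegrand (μ : ℝ) (η : ℝ → ℝ) (n : ℤ) (f : ℝ → ℂ) (b : ℝ) : ℂ :=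
  ((b ^ (-(2 * μ)) * WFun μ η n b : ℝ) : ℂ) * Complex.exp (-(Complex.I * (n : ℂ) * (b : ℂ))) * f b

theorem kernel_eq (f : ℝ → ℂ) (β b : ℝ) :
    ((b ^ (-(2 * μ)) * WFun μ η n b : ℝ) : ℂ) *
        Complex.exp (Complex.I * (n : ℂ) * ((β : ℂ) - (b : ℂ))) * f b =
      Complex.exp (Complex.I * (n : ℂ) * (β : ℂ)) * kernelIntegrand μ η n f b := by
  rw [kernelIntegrand, mul_sub, sub_eq_add_neg, Complex.exp_add]
  ring

theorem continuousOn_kernelIntegrand (hη : Continuous η) {f : ℝ → ℂ}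
    (hf : ContinuousOn f (Ioi 0)) : ContinuousOn (kernelIntegrand μ η n f) (Ioi 0) := by
  refine ContinuousOn.mul (ContinuousOn.mul ?_ ?_) hf
  · exact Complex.continuous_ofReal.comp_continuousOn (continuousOn_rpow_mul_WFun hη _)
  · fun_prop

theorem norm_kernelIntegrand_le {f : ℝ → ℂ} {s b : ℝ} (hb : 0 < b) (hf : ‖f b‖ ≤ b ^ (-s)) :
    ‖kernelIntegrand μ η n f b‖ ≤ b ^ (-(2 * μ)) * WFun μ η n b * b ^ (-s) := by
  convert norm_kernel_le (μ := μ) (η := η) (n := n) 0 hb hf using 2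
  rw [kernel_eq]
  simp

/-- On the half-line, `Lminus` is an explicit factor times an antiderivative of
`kernelIntegrand`. -/
theorem exists_Lminus_eq (hη : Continuous η) {f : ℝ → ℂ} {s c : ℝ} (hc : 0 < c)
    (hfc : ContinuousOn f (Ioi 0)) (hf : ∀ b > 0, ‖f b‖ ≤ b ^ (-s))
    (h2 : 2 ≤ |n| → ∀ b > 0, c ≤ aFun μ η n b + (1 - 2 * μ - s))
    (h1 : ¬ 2 ≤ |n| → ∀ b > 0, aFun μ η n b + (1 - 2 * μ - s) ≤ -c) :
    ∃ A : ℂ, ∀ β > 0, Lminus μ η n f β =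
      -(((β ^ (1 - 2 * μ) * WFun μ η n β : ℝ) : ℂ)⁻¹ *
        Complex.exp (Complex.I * (n : ℂ) * (β : ℂ)) *
        (A + ∫ b in (1 : ℝ)..β, kernelIntegrand μ η n f b)) := by
  have hG := continuousOn_kernelIntegrand (μ := μ) (n := n) hη hfc
  have hcoef : ∀ β > 0, β ^ (2 * μ - 1) / WFun μ η n β =
      (β ^ (1 - 2 * μ) * WFun μ η n β)⁻¹ := fun β hβ => by
    rw [show 1 - 2 * μ = -(2 * μ - 1) by ring, Real.rpow_neg (le_of_lt hβ), mul_inv, inv_inv]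
    rfl
  by_cases hn : 2 ≤ |n|
  · refine ⟨∫ b in (0 : ℝ)..1, kernelIntegrand μ η n f b, fun β hβ => ?_⟩
    have hint : ∀ R > 0, IntervalIntegrable (kernelIntegrand μ η n f) volume 0 R := fun R hR => by
      rw [intervalIntegrable_iff_integrableOn_Ioc_of_le (le_of_lt hR)]
      refine Integrable.mono' (integral_weight_Ioc hη hc hR (h2 hn)).1
        ((hG.mono fun b hb => hb.1).aestronglyMeasurable measurableSet_Ioc) ?_
      filter_upwards [ae_restrict_mem measurableSet_Ioc] with b hb
      exact norm_kernelIntegrand_le hb.1 (hf b hb.1)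
    rw [intervalIntegral.integral_add_adjacent_intervals (hint 1 one_pos)
      ((hint 1 one_pos).symm.trans (hint β hβ)), Lminus, if_pos hn]
    simp only [kernel_eq]
    rw [intervalIntegral.integral_const_mul, hcoef β hβ, Complex.ofReal_inv]
    ring
  · refine ⟨-∫ b in Ioi 1, kernelIntegrand μ η n f b, fun β hβ => ?_⟩
    have hint : ∀ R > 0, IntegrableOn (kernelIntegrand μ η n f) (Ioi R) := fun R hR => by
      refine Integrable.mono' (integral_weight_Ioi hη hc hR (h1 hn)).1
        ((hG.mono (Ioi_subset_Ioi (le_of_lt hR))).aestronglyMeasurable measurableSet_Ioi) ?_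
      filter_upwards [ae_restrict_mem measurableSet_Ioi] with b hb
      have hb0 := lt_trans hR hb
      exact norm_kernelIntegrand_le hb0 (hf b hb0)
    rw [← intervalIntegral.integral_Ioi_sub_Ioi' (hint 1 one_pos) (hint β hβ), Lminus, if_neg hn]
    simp only [kernel_eq]
    rw [MeasureTheory.integral_const_mul, hcoef β hβ, Complex.ofReal_inv]
    ring

/-- The ordinary differential equation satisfied by `Lminus`. -/
theorem hasDerivAt_Lminus (hη : Continuous η) {f : ℝ → ℂ} {s c β : ℝ} (hc : 0 < c) (hβ : 0 < β)
    (hfc : ContinuousOn f (Ioi 0)) (hf : ∀ b > 0, ‖f b‖ ≤ b ^ (-s))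
    (h2 : 2 ≤ |n| → ∀ b > 0, c ≤ aFun μ η n b + (1 - 2 * μ - s))
    (h1 : ¬ 2 ≤ |n| → ∀ b > 0, aFun μ η n b + (1 - 2 * μ - s) ≤ -c) :
    HasDerivAt (Lminus μ η n f)
      (Complex.I * n * Lminus μ η n f β -
        (((aFun μ η n β + (1 - 2 * μ) : ℝ) : ℂ) * Lminus μ η n f β + f β) / β) β := by
  obtain ⟨A, hA⟩ := exists_Lminus_eq hη hc hfc hf h2 h1
  have hG := continuousOn_kernelIntegrand (μ := μ) (n := n) hη hfc
  have hsub : uIcc 1 β ⊆ Ioi (0 : ℝ) := fun b hb => (lt_min one_pos hβ).trans_le hb.1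
  have hprim := (intervalIntegral.integral_hasDerivAt_right (hG.mono hsub).intervalIntegrable
    (hG.stronglyMeasurableAtFilter isOpen_Ioi β hβ)
    (hG.continuousAt (Ioi_mem_nhds hβ))).const_add A
  have hw := (hasDerivAt_rpow_mul_WFun (μ := μ) (n := n) hη (1 - 2 * μ) hβ).ofReal_comp
  have hw0 : ((β ^ (1 - 2 * μ) * WFun μ η n β : ℝ) : ℂ) ≠ 0 :=
    Complex.ofReal_ne_zero.2 (mul_pos (Real.rpow_pos_of_pos hβ _) (WFun_pos β)).ne'
  have hexp : HasDerivAt (fun b : ℝ => Complex.exp (Complex.I * (n : ℂ) * (b : ℂ)))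
      (Complex.exp (Complex.I * (n : ℂ) * (β : ℂ)) * (Complex.I * n * 1)) β :=
    ((Complex.ofRealCLM.hasDerivAt (x := β)).const_mul (Complex.I * (n : ℂ))).cexp
  have hder := ((((hw.inv hw0).mul hexp).mul hprim).neg).congr_of_eventuallyEq
    ((eventually_gt_nhds hβ).mono fun b hb => hA b hb)
  refine hder.congr_deriv ?_
  have hβ' : (β : ℂ) ≠ 0 := Complex.ofReal_ne_zero.2 hβ.ne'
  have hG' : f β / β = ((β ^ (1 - 2 * μ) * WFun μ η n β : ℝ) : ℂ)⁻¹ *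
      Complex.exp (Complex.I * (n : ℂ) * (β : ℂ)) * kernelIntegrand μ η n f β := by
    have hw1 := weight_eq (μ := μ) (η := η) (n := n) 0 hβ
    rw [neg_zero, Real.rpow_zero, mul_one, sub_zero] at hw1
    rw [kernelIntegrand, hw1, Complex.exp_neg, Complex.ofReal_div]
    have := Complex.exp_ne_zero (Complex.I * (n : ℂ) * (β : ℂ))
    field_simp
  rw [add_div, hG', hA β hβ]
  simp only [Pi.inv_apply, Pi.mul_apply]
  push_cast at hw0 ⊢
  generalize (∫ b in (1 : ℝ)..β, kernelIntegrand μ η n f b) = J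
  field_simp
  ring

end Kernel

/-- A continuous function on `[0,∞)` with a limit at infinity is bounded. -/
theorem exists_norm_le_of_continuousOn_of_tendsto {E : Type*} [NormedAddCommGroup E] {f : ℝ → E}
    {L : E} (hf : ContinuousOn f (Ici 0)) (hL : Tendsto f atTop (𝓝 L)) :
    ∃ B, ∀ b ≥ 0, ‖f b‖ ≤ B := by
  obtain ⟨R, hR⟩ := eventually_atTop.1 (hL.norm.eventually (gt_mem_nhds (lt_add_one ‖L‖)))
  obtain ⟨B, hB⟩ := (isCompact_Icc (a := (0 : ℝ)) (b := R)).exists_bound_of_continuousOn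
    (hf.mono fun b hb => hb.1)
  refine ⟨max B (‖L‖ + 1), fun b hb => ?_⟩
  rcases le_total b R with h | h
  · exact (hB b ⟨hb, h⟩).trans (le_max_left _ _)
  · exact (hR b h).le.trans (le_max_right _ _)

theorem supN_nonneg (f : ℝ → ℂ) : 0 ≤ supN f := Real.iSup_nonneg fun _ => norm_nonneg _

theorem hoel_nonneg (δ : ℝ) (f : ℝ → ℂ) (L : ℂ) : 0 ≤ hoel δ f L :=
  Real.iSup_nonneg fun β => mul_nonneg (Real.rpow_nonneg (le_of_lt β.2) _) (norm_nonneg _)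

theorem norm_le_supN {δ : ℝ} {f : ℝ → ℂ} {L : ℂ} (hf : MemCdelta δ f L) {b : ℝ} (hb : 0 ≤ b) :
    ‖f b‖ ≤ supN f := by
  obtain ⟨B, hB⟩ := exists_norm_le_of_continuousOn_of_tendsto hf.1 hf.2.1
  exact le_ciSup (f := fun β : Ici (0 : ℝ) => ‖f (β : ℝ)‖)
    ⟨B, by rintro _ ⟨β, rfl⟩; exact hB β β.2⟩ ⟨b, hb⟩

theorem rpow_mul_norm_le_hoel {δ : ℝ} {f : ℝ → ℂ} {L : ℂ} (hf : MemCdelta δ f L) {b : ℝ}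
    (hb : 0 < b) : b ^ δ * ‖f b - L‖ ≤ hoel δ f L :=
  le_ciSup (f := fun β : Ioi (0 : ℝ) => (β : ℝ) ^ δ * ‖f (β : ℝ) - L‖) hf.2.2 ⟨b, hb⟩

theorem normC_le_of_forall {δ ε : ℝ} {f : ℝ → ℂ} (hf : ∀ b ≥ 0, (1 + b ^ δ) * ‖f b‖ ≤ ε) :
    normC δ f 0 ≤ 2 * ε := by
  have hsup : supN f ≤ ε := ciSup_le fun β => by
    have := mul_nonneg (Real.rpow_nonneg β.2 δ) (norm_nonneg (f β))
    linarith [hf β β.2]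
  have hhoel : hoel δ f 0 ≤ ε := ciSup_le fun β => by
    rw [sub_zero]
    linarith [hf β (le_of_lt β.2), norm_nonneg (f β)]
  unfold normC
  linarith

/-- Multiplication by a function decaying like `1/β` turns bounded, uniformly Lipschitz sequences
into relatively compact sequences in `𝒞^δ`. -/
theorem exists_subseq_tendsto_normC {δ : ℝ} (hδ0 : 0 < δ) (hδ1 : δ < 1) {m : ℝ → ℂ} {l : ℂ}
    (hm : ContinuousOn m (Ici 0)) (hml : Tendsto (fun β : ℝ => (β : ℂ) * m β) atTop (𝓝 l))
    {B : ℝ} {C : NNReal} {T F : ℕ → ℝ → ℂ} (hB : ∀ k, ∀ β ≥ 0, ‖T k β‖ ≤ B)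
    (hL : ∀ k, LipschitzOnWith C (T k) (Ici 0)) (hF : ∀ k, ∀ β ≥ 0, F k β = m β * T k β) :
    ∃ φ : ℕ → ℕ, StrictMono φ ∧ ∃ g : ℝ → ℂ, MemCdelta δ g 0 ∧
      Tendsto (fun j : ℕ => normC δ (fun β => F (φ j) β - g β) 0) atTop (𝓝 0) := by
  have hLext : ∀ k, LipschitzWith C fun x => T k (max x 0) := fun k => by
    refine LipschitzWith.of_dist_le_mul fun x y => ?_
    refine ((hL k).dist_le_mul _ (mem_Ici.2 (le_max_right _ _)) _
      (mem_Ici.2 (le_max_right _ _))).trans ?_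
    refine mul_le_mul_of_nonneg_left ?_ C.2
    simpa [Real.dist_eq] using abs_max_sub_max_le_abs x y 0
  obtain ⟨h₀, hh₀, φ, hφ, hlim⟩ := exists_subseq_tendsto_of_lipschitzWith (B := B)
    (fun k => ⟨fun x => T k (max x 0), (hLext k).continuous⟩) hLext
    fun k x => hB k _ (le_max_right _ _)
  have hB0 : 0 ≤ B := (norm_nonneg _).trans (hh₀ 0)
  let q : ℝ → ℝ := fun β => (1 + β ^ δ) * ‖m β‖
  have hq0 : ∀ β ≥ 0, 0 ≤ q β := fun β hβ =>
    mul_nonneg (add_nonneg zero_le_one (Real.rpow_nonneg hβ _)) (norm_nonneg _)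
  have hqc : ContinuousOn q (Ici 0) :=
    (continuous_const.add (Real.continuous_rpow_const hδ0.le)).continuousOn.mul hm.norm
  have hqlim : Tendsto q atTop (𝓝 0) := by
    have h1 : Tendsto (fun β : ℝ => β⁻¹ + β ^ (-(1 - δ))) atTop (𝓝 0) := by
      simpa using tendsto_inv_atTop_zero.add (tendsto_rpow_neg_atTop (sub_pos.2 hδ1))
    have h2 := h1.mul hml.norm
    rw [zero_mul] at h2
    refine h2.congr' ((eventually_gt_atTop 0).mono fun β hβ => ?_)
    simp only [q, norm_mul, Complex.norm_real, Real.norm_of_nonneg hβ.le]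
    rw [show -(1 - δ) = δ - 1 by ring, Real.rpow_sub_one hβ.ne']
    field_simp
  obtain ⟨N, hN⟩ := exists_norm_le_of_continuousOn_of_tendsto hqc hqlim
  have hqN : ∀ β ≥ 0, q β ≤ N := fun β hβ => (le_abs_self _).trans (hN β hβ)
  have hN0 : 0 ≤ N := (hq0 0 le_rfl).trans (hqN 0 le_rfl)
  have hmq : ∀ β ≥ 0, ‖m β‖ ≤ q β := fun β hβ => by
    have := mul_nonneg (Real.rpow_nonneg hβ δ) (norm_nonneg (m β))
    simp only [q]
    linarith
  refine ⟨φ, hφ, fun β => m β * h₀ β, ⟨hm.mul h₀.continuous.continuousOn, ?_, ?_⟩, ?_⟩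
  · have h1 : Tendsto (fun β => q β * B) atTop (𝓝 0) := by simpa using hqlim.mul_const B
    refine squeeze_zero_norm' ((eventually_ge_atTop 0).mono fun β hβ => ?_) h1
    rw [norm_mul]
    exact mul_le_mul (hmq β hβ) (hh₀ β) (norm_nonneg _) (hq0 β hβ)
  · refine ⟨N * B, ?_⟩
    rintro _ ⟨β, rfl⟩
    have hβ : (0 : ℝ) ≤ β := le_of_lt β.2
    simp only [sub_zero, norm_mul]
    rw [← mul_assoc]
    refine mul_le_mul (le_trans ?_ (hqN β hβ)) (hh₀ β) (norm_nonneg _) hN0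
    simp only [q]
    linarith [norm_nonneg (m β)]
  · rw [Metric.tendsto_atTop]
    intro ε hε
    obtain ⟨R, hR⟩ := eventually_atTop.1 (hqlim.eventually
      (gt_mem_nhds (show 0 < ε / 3 / (2 * B + 1) by positivity)))
    have hunif := ContinuousMap.tendsto_iff_forall_isCompact_tendstoUniformlyOn.1 hlim
      (Icc 0 R) isCompact_Icc
    obtain ⟨J, hJ⟩ := eventually_atTop.1 (Metric.tendstoUniformlyOn_iff.1 hunif
      (ε / 3 / (N + 1)) (by positivity))
    refine ⟨J, fun j hj => ?_⟩
    have hle : normC δ (fun β => F (φ j) β - m β * h₀ β) 0 ≤ 2 * (ε / 3) := by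
      refine normC_le_of_forall fun β hβ => ?_
      have hfact : (1 + β ^ δ) * ‖F (φ j) β - m β * h₀ β‖ = q β * ‖T (φ j) β - h₀ β‖ := by
        rw [hF _ β hβ, ← mul_sub, norm_mul, mul_assoc]
      rw [hfact]
      rcases le_total β R with hβR | hβR
      · have h1 := (hJ j hj β ⟨hβ, hβR⟩).le
        rw [dist_comm, dist_eq_norm] at h1
        simp only [Function.comp_apply, ContinuousMap.coe_mk, max_eq_left hβ] at h1
        calc _ ≤ (N + 1) * (ε / 3 / (N + 1)) :=
              mul_le_mul ((hqN β hβ).trans (by linarith)) h1 (norm_nonneg _) (by positivity)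
          _ = ε / 3 := by field_simp
      · have h1 : ‖T (φ j) β - h₀ β‖ ≤ 2 * B + 1 :=
          (norm_sub_le _ _).trans (by linarith [hB (φ j) β hβ, hh₀ β])
        calc _ ≤ ε / 3 / (2 * B + 1) * (2 * B + 1) :=
              mul_le_mul (hR β hβR).le h1 (norm_nonneg _) (by positivity)
          _ = ε / 3 := by field_simp
    have h0 : 0 ≤ normC δ (fun β => F (φ j) β - m β * h₀ β) 0 :=
      add_nonneg (supN_nonneg _) (hoel_nonneg _ _ _)
    rw [Real.dist_eq, sub_zero, abs_of_nonneg h0]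
    linarith

/-- Oscillation bound: a bounded solution of `g' = i n g - (p g + f)/b` has bounded integral as soon
as `f` and `g` decay like `b ^ (-δ)`. -/
theorem norm_integral_le_of_oscillation {n : ℤ} (hn : n ≠ 0) {δ M P : ℝ} (hδ : 0 < δ)
    (hP : 0 ≤ P) {f g : ℝ → ℂ} {p : ℝ → ℝ} (hf : ContinuousOn f (Ioi 0)) (hp : Continuous p)
    (hd : ∀ b > 0, HasDerivAt g (Complex.I * n * g b - ((p b : ℂ) * g b + f b) / b) b)
    (hpP : ∀ b, |p b| ≤ P) (hM : ∀ b > 0, ‖g b‖ ≤ M)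
    (hMδ : ∀ b > 0, ‖g b‖ ≤ M * b ^ (-δ)) (hfδ : ∀ b > 0, ‖f b‖ ≤ b ^ (-δ))
    {β : ℝ} (hβ : 1 ≤ β) : ‖∫ b in (1 : ℝ)..β, g b‖ ≤ 2 * M + (P * M + 1) / δ := by
  have hsub : uIcc 1 β ⊆ Ioi (0 : ℝ) := fun b hb => by
    rw [uIcc_of_le hβ] at hb
    exact one_pos.trans_le hb.1
  have hg : ContinuousOn g (uIcc 1 β) := fun b hb =>
    (hd b (hsub hb)).continuousAt.continuousWithinAt
  have hr : ContinuousOn (fun b : ℝ => ((p b : ℂ) * g b + f b) / b) (uIcc 1 β) :=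
    (((Complex.continuous_ofReal.comp hp).continuousOn.mul hg).add (hf.mono hsub)).div
      Complex.continuous_ofReal.continuousOn fun b hb =>
        Complex.ofReal_ne_zero.2 (ne_of_gt (hsub hb))
  have hig := (hg.intervalIntegrable (μ := volume)).const_mul (Complex.I * (n : ℂ))
  have hir := hr.intervalIntegrable (μ := volume)
  have hftc := intervalIntegral.integral_eq_sub_of_hasDerivAt
    (fun b hb => hd b (hsub hb)) (hig.sub hir)
  rw [intervalIntegral.integral_sub hig hir, intervalIntegral.integral_const_mul] at hftc
  have hpow : IntegrableOn (fun b : ℝ => b ^ (-δ - 1)) (Ioi 1) :=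
    integrableOn_Ioi_rpow_of_lt (by linarith) one_pos
  have hrem : ‖∫ b in (1 : ℝ)..β, ((p b : ℂ) * g b + f b) / b‖ ≤ (P * M + 1) / δ := by
    have hM0 : 0 ≤ M := (norm_nonneg _).trans (hM 1 one_pos)
    rw [intervalIntegral.integral_of_le hβ]
    calc _ ≤ ∫ b in Ioc 1 β, (P * M + 1) * b ^ (-δ - 1) := by
          refine norm_integral_le_of_norm_le
            ((hpow.mono_set Ioc_subset_Ioi_self).const_mul _) ?_
          filter_upwards [ae_restrict_mem measurableSet_Ioc] with b hb
          have hb0 : 0 < b := one_pos.trans hb.1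
          rw [norm_div, Complex.norm_real, Real.norm_of_nonneg hb0.le, Real.rpow_sub_one hb0.ne',
            ← mul_div_assoc]
          refine div_le_div_of_nonneg_right ?_ hb0.le
          calc _ ≤ |p b| * ‖g b‖ + ‖f b‖ := by
                refine (norm_add_le _ _).trans_eq ?_
                rw [norm_mul, Complex.norm_real, Real.norm_eq_abs]
            _ ≤ P * (M * b ^ (-δ)) + b ^ (-δ) :=
                add_le_add (mul_le_mul (hpP b) (hMδ b hb0) (norm_nonneg _) hP) (hfδ b hb0)
            _ = _ := by ring
      _ ≤ ∫ b in Ioi 1, (P * M + 1) * b ^ (-δ - 1) := by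
          refine setIntegral_mono_set (hpow.const_mul _) ?_ Ioc_subset_Ioi_self.eventuallyLE
          filter_upwards [ae_restrict_mem measurableSet_Ioi] with b hb
          exact mul_nonneg (by positivity) (Real.rpow_nonneg (one_pos.trans hb).le _)
      _ = (P * M + 1) / δ := by
          rw [MeasureTheory.integral_const_mul, integral_Ioi_rpow_of_lt (by linarith) one_pos,
            Real.one_rpow, sub_add_cancel, neg_div_neg_eq, mul_one_div]
  have hn1 : 1 ≤ ‖Complex.I * (n : ℂ)‖ := by
    rw [norm_mul, Complex.norm_I, one_mul, Complex.norm_intCast]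
    exact_mod_cast Int.one_le_abs hn
  calc _ ≤ ‖Complex.I * (n : ℂ)‖ * ‖∫ b in (1 : ℝ)..β, g b‖ :=
        le_mul_of_one_le_left (norm_nonneg _) hn1
    _ = ‖g β - g 1 + ∫ b in (1 : ℝ)..β, ((p b : ℂ) * g b + f b) / b‖ := by
        rw [← norm_mul, ← hftc, sub_add_cancel]
    _ ≤ ‖g β‖ + ‖g 1‖ + ‖∫ b in (1 : ℝ)..β, ((p b : ℂ) * g b + f b) / b‖ :=
        (norm_add_le _ _).trans (by gcongr; exact norm_sub_le _ _)
    _ ≤ _ := by linarith [hM β (one_pos.trans_le hβ), hM 1 one_pos]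

section Coefficients

variable {μ : ℝ} {η : ℝ → ℝ} {n : ℤ}

theorem one_le_sq_of_ne_zero (hn : n ≠ 0) : (1 : ℝ) ≤ (n : ℝ) ^ 2 := by
  have h : 1 ≤ n ^ 2 := Int.add_one_le_iff.2 (sq_pos_iff.2 hn)
  exact_mod_cast h

theorem radicand_pos (hμ : 1 < μ) (hη : ∀ β, η β ≤ 1) (hn : n ≠ 0) (β : ℝ) :
    0 < (n : ℝ) ^ 2 * μ ^ 2 - (2 * μ - 1) * η β := by
  have h1 := one_le_sq_of_ne_zero hn
  nlinarith [hη β, mul_le_mul_of_nonneg_right h1 (sq_nonneg μ), mul_pos (sub_pos.2 hμ) (sub_pos.2 hμ),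
    mul_le_mul_of_nonneg_left (hη β) (show 0 ≤ 2 * μ - 1 by linarith)]

theorem aFun_pos (hμ : 1 < μ) (hη : ∀ β, η β ≤ 1) (hn : n ≠ 0) (β : ℝ) : 0 < aFun μ η n β :=
  Real.sqrt_pos.2 (radicand_pos hμ hη hn β)

theorem aFun_le (hμ : 1 < μ) (hη : ∀ β, 0 ≤ η β) (β : ℝ) : aFun μ η n β ≤ |(n : ℝ)| * μ := by
  have h := mul_nonneg (show 0 ≤ 2 * μ - 1 by linarith) (hη β)
  refine Real.sqrt_le_iff.2 ⟨by positivity, ?_⟩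
  rw [mul_pow, sq_abs]
  linarith

theorem sqrt_le_aFun (hμ : 1 < μ) (hη : ∀ β, η β ≤ 1) (hn : 2 ≤ |n|) (β : ℝ) :
    Real.sqrt (4 * μ ^ 2 - 2 * μ + 1) ≤ aFun μ η n β := by
  have h4 : (4 : ℝ) ≤ (n : ℝ) ^ 2 := by
    rw [← sq_abs]
    have : (2 : ℝ) ≤ |(n : ℝ)| := by exact_mod_cast hn
    nlinarith
  refine Real.sqrt_le_sqrt ?_
  nlinarith [mul_le_mul_of_nonneg_right h4 (sq_nonneg μ),
    mul_le_mul_of_nonneg_left (hη β) (show 0 ≤ 2 * μ - 1 by linarith)]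

theorem contDiff_chiFun (hμ : 1 < μ) (hη : ContDiff ℝ (⊤ : ℕ∞) η) (hη1 : ∀ β, η β ≤ 1)
    (hn : n ≠ 0) : ContDiff ℝ 1 (chiFun μ η n) := by
  have h1 : ContDiff ℝ 1 η := hη.of_le (by exact_mod_cast le_top)
  have h2 : ContDiff ℝ 1 (deriv η) :=
    ((contDiff_infty_iff_deriv.1 hη).2).of_le (by exact_mod_cast le_top)
  have ha : ContDiff ℝ 1 (aFun μ η n) :=
    ContDiff.sqrt (contDiff_const.sub (contDiff_const.mul h1))
      fun β => (radicand_pos hμ hη1 hn β).ne'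
  exact h1.sub ((contDiff_id.mul h2).div (contDiff_const.mul ha)
    fun β => (mul_pos two_pos (aFun_pos hμ hη1 hn β)).ne')

theorem chiFun_eq_zero (hη0 : ∀ β : ℝ, β ≤ 1 → η β = 0) {β : ℝ} (hβ : β < 1) :
    chiFun μ η n β = 0 := by
  have h : η =ᶠ[𝓝 β] fun _ => 0 := (eventually_lt_nhds hβ).mono fun b hb => hη0 b hb.le
  simp [chiFun, h.deriv_eq, hη0 β hβ.le]

theorem chiFun_eq_one (hη1 : ∀ β : ℝ, 2 ≤ β → η β = 1) {β : ℝ} (hβ : 2 < β) :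
    chiFun μ η n β = 1 := by
  have h : η =ᶠ[𝓝 β] fun _ => 1 := (eventually_gt_nhds hβ).mono fun b hb => hη1 b hb.le
  simp [chiFun, h.deriv_eq, hη1 β hβ.le]

end Coefficients

/-- The primitive of `Lminus f` vanishing at the origin is bounded and Lipschitz, uniformly over the
unit ball of `𝒞^δ_0`. -/
theorem exists_bound_primitive_Lminus {μ δ : ℝ} (hμ : 1 < μ) (hδ0 : 0 < δ)
    (hδ1 : δ < Real.sqrt (4 * μ ^ 2 - 2 * μ + 1) - 2 * μ + 1) {η : ℝ → ℝ} (hη : Continuous η)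
    (hη_range : ∀ β, 0 ≤ η β ∧ η β ≤ 1) {n : ℤ} (hn : n ≠ 0) :
    ∃ (B : ℝ) (C : NNReal), ∀ f : ℝ → ℂ, MemCdelta δ f 0 → normC δ f 0 ≤ 1 →
      (∀ β ≥ 0, ‖∫ b in (0 : ℝ)..β, Lminus μ η n f b‖ ≤ B) ∧
        LipschitzOnWith C (fun β => ∫ b in (0 : ℝ)..β, Lminus μ η n f b) (Ici 0) := by
  let c : ℝ := min (Real.sqrt (4 * μ ^ 2 - 2 * μ + 1) - 2 * μ + 1 - δ) (μ - 1)
  have hc : 0 < c := lt_min (by linarith) (by linarith)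
  have h2 : ∀ s ≤ δ, 2 ≤ |n| → ∀ b > 0, c ≤ aFun μ η n b + (1 - 2 * μ - s) := by
    intro s hs hn2 b _
    have := sqrt_le_aFun hμ (fun β => (hη_range β).2) hn2 b
    exact (min_le_left _ _).trans (by linarith)
  have h1 : ∀ s ≥ 0, ¬ 2 ≤ |n| → ∀ b > 0, aFun μ η n b + (1 - 2 * μ - s) ≤ -c := by
    intro s hs hn2 b _
    have hn1 : |(n : ℝ)| ≤ 1 := by exact_mod_cast Int.lt_add_one_iff.1 (not_le.1 hn2)
    have ha := aFun_le (n := n) hμ (fun β => (hη_range β).1) b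
    have : |(n : ℝ)| * μ ≤ 1 * μ := mul_le_mul_of_nonneg_right hn1 (by linarith)
    linarith [min_le_right (Real.sqrt (4 * μ ^ 2 - 2 * μ + 1) - 2 * μ + 1 - δ) (μ - 1)]
  let M : ℝ := 1 / c
  have hM0 : 0 < M := one_div_pos.2 hc
  let P : ℝ := |(n : ℝ)| * μ + 2 * μ
  have hP : 0 ≤ P := by positivity
  refine ⟨M + (2 * M + (P * M + 1) / δ), M.toNNReal, fun f hf hf1 => ?_⟩
  have hfc : ContinuousOn f (Ioi 0) := hf.1.mono Ioi_subset_Ici_self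
  have hf0 : ∀ b > 0, ‖f b‖ ≤ b ^ (-(0 : ℝ)) := fun b hb => by
    rw [neg_zero, Real.rpow_zero]
    have := norm_le_supN hf (le_of_lt hb)
    unfold normC at hf1
    linarith [hoel_nonneg δ f 0]
  have hfδ : ∀ b > 0, ‖f b‖ ≤ b ^ (-δ) := fun b hb => by
    have := rpow_mul_norm_le_hoel hf hb
    unfold normC at hf1
    rw [sub_zero] at this
    rw [Real.rpow_neg (le_of_lt hb), ← one_div, le_div_iff₀ (Real.rpow_pos_of_pos hb δ)]
    linarith [supN_nonneg f]
  have hL0 : ∀ b > 0, ‖Lminus μ η n f b‖ ≤ M := fun b hb => by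
    simpa [M] using norm_Lminus_le hη hc hb hf0 (h2 0 hδ0.le) (h1 0 le_rfl)
  have hLδ : ∀ b > 0, ‖Lminus μ η n f b‖ ≤ M * b ^ (-δ) := fun b hb =>
    (norm_Lminus_le hη hc hb hfδ (h2 δ le_rfl) (h1 δ hδ0.le)).trans_eq (by simp only [M]; ring)
  have hd := fun b (hb : b > 0) => hasDerivAt_Lminus hη hc hb hfc hfδ (h2 δ le_rfl) (h1 δ hδ0.le)
  have hint : ∀ β ≥ 0, IntervalIntegrable (Lminus μ η n f) volume 0 β := fun β hβ => by
    rw [intervalIntegrable_iff_integrableOn_Ioc_of_le hβ]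
    refine Integrable.of_bound ?_ M ?_
    · exact ContinuousOn.aestronglyMeasurable
        (fun b hb => (hd b hb.1).continuousAt.continuousWithinAt) measurableSet_Ioc
    · filter_upwards [ae_restrict_mem measurableSet_Ioc] with b hb
      exact hL0 b hb.1
  have hlip : ∀ x ≥ 0, ∀ y ≥ 0, ‖∫ b in x..y, Lminus μ η n f b‖ ≤ M * |y - x| := fun x hx y hy =>
    intervalIntegral.norm_integral_le_of_norm_le_const fun b hb =>
      hL0 b ((le_min hx hy).trans_lt hb.1)
  have htail : 0 ≤ 2 * M + (P * M + 1) / δ := by positivity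
  constructor
  · intro β hβ
    rcases le_total β 1 with hβ1 | hβ1
    · have := hlip 0 le_rfl β hβ
      rw [sub_zero, abs_of_nonneg hβ] at this
      nlinarith
    · have hone := hlip 0 le_rfl 1 zero_le_one
      rw [sub_zero, abs_one, mul_one] at hone
      rw [← intervalIntegral.integral_add_adjacent_intervals (hint 1 zero_le_one)
        ((hint 1 zero_le_one).symm.trans (hint β hβ))]
      refine (norm_add_le _ _).trans (add_le_add hone ?_)
      refine norm_integral_le_of_oscillation hn hδ0 hP hfc
        ((continuous_aFun (μ := μ) (n := n) hη).add continuous_const) hd (fun b => ?_)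
        hL0 hLδ hfδ hβ1
      have h3 := aFun_pos hμ (fun β => (hη_range β).2) hn b
      have h4 := aFun_le (n := n) hμ (fun β => (hη_range β).1) b
      simp only [P, abs_le, Pi.add_apply]
      constructor <;> nlinarith [abs_nonneg (n : ℝ)]
  · refine LipschitzOnWith.of_dist_le_mul fun x hx y hy => ?_
    rw [dist_eq_norm, intervalIntegral.integral_interval_sub_left (hint x hx) (hint y hy),
      Real.coe_toNNReal M hM0.le, Real.dist_eq]
    exact hlip y hy x hx

/-- On `[0,∞)`, each `Kop` is multiplication by a continuous function decaying like `1/β` applied to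
the primitive of `Lminus f`. -/
theorem exists_Kop_eq_mul_primitive {μ : ℝ} (hμ : 1 < μ) {η : ℝ → ℝ}
    (hη_smooth : ContDiff ℝ (⊤ : ℕ∞) η) (hη_le : ∀ β, η β ≤ 1)
    (hη0 : ∀ β : ℝ, β ≤ 1 → η β = 0) (hη1 : ∀ β : ℝ, 2 ≤ β → η β = 1) {n : ℤ} (hn : n ≠ 0)
    (i : Fin 3) :
    ∃ (m : ℝ → ℂ) (l : ℂ), ContinuousOn m (Ici 0) ∧
      Tendsto (fun β : ℝ => (β : ℂ) * m β) atTop (𝓝 l) ∧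
      ∀ f : ℝ → ℂ, ∀ β ≥ 0,
        Kop μ η n i f β = m β * ∫ b in (0 : ℝ)..β, Lminus μ η n f b := by
  have hχ := contDiff_chiFun hμ hη_smooth hη_le hn
  have hχ0 : ∀ {β : ℝ}, β < 1 → chiFun μ η n β = 0 := chiFun_eq_zero hη0
  have hχ1 : ∀ {β : ℝ}, 2 < β → chiFun μ η n β = 1 := chiFun_eq_one hη1
  have hχ' : Continuous (deriv (chiFun μ η n)) := hχ.continuous_deriv le_rfl
  have havg : ∀ (f : ℝ → ℂ) {β : ℝ}, 0 < β → Avg (Lminus μ η n f) β =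
      (β : ℂ)⁻¹ * ∫ b in (0 : ℝ)..β, Lminus μ η n f b := fun f β hβ => by
    rw [Avg, if_neg hβ.ne', Complex.ofReal_inv]
  match i with
  | 0 =>
    refine ⟨fun β => (chiFun μ η n β : ℂ) * (β : ℂ)⁻¹, 1, ?_, ?_, ?_⟩
    · intro β hβ
      refine ContinuousAt.continuousWithinAt ?_
      rcases (mem_Ici.1 hβ).eq_or_lt with rfl | hβ0
      · refine (continuousAt_const (y := (0 : ℂ))).congr ?_
        filter_upwards [eventually_lt_nhds (show (0 : ℝ) < 1 from one_pos)] with b hb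
        simp [hχ0 hb]
      · exact (Complex.continuous_ofReal.comp hχ.continuous).continuousAt.mul
          (Complex.continuous_ofReal.continuousAt.inv₀ (Complex.ofReal_ne_zero.2 hβ0.ne'))
    · refine tendsto_const_nhds.congr' ((eventually_gt_atTop 2).mono fun β hβ => ?_)
      have : (β : ℂ) ≠ 0 := Complex.ofReal_ne_zero.2 (by linarith)
      simp [hχ1 hβ, this]
    · intro f β hβ
      rcases hβ.eq_or_lt with rfl | hβ0
      · simp [Kop, K1, hχ0 one_pos]
      · simp only [Kop, K1]
        rw [havg f hβ0, mul_assoc]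
  | 1 =>
    refine ⟨fun β => ((deriv (chiFun μ η n) β : ℝ) : ℂ), 0,
      (Complex.continuous_ofReal.comp hχ').continuousOn, ?_, ?_⟩
    · refine tendsto_const_nhds.congr' ((eventually_gt_atTop 2).mono fun β hβ => ?_)
      have h : chiFun μ η n =ᶠ[𝓝 β] fun _ => 1 := (eventually_gt_nhds hβ).mono fun b hb => hχ1 hb
      simp [h.deriv_eq]
    · intro f β hβ
      rcases hβ.eq_or_lt with rfl | hβ0
      · simp [Kop, K2]
      · have : (β : ℂ) ≠ 0 := Complex.ofReal_ne_zero.2 hβ0.ne'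
        simp only [Kop, K2]
        rw [havg f hβ0, Complex.ofReal_mul]
        field_simp
  | 2 =>
    refine ⟨fun β => ((1 - chiFun μ η n β : ℝ) : ℂ) * (Complex.I * (n : ℂ)), 0, ?_, ?_, ?_⟩
    · exact ((Complex.continuous_ofReal.comp (continuous_const.sub hχ.continuous)).mul
        continuous_const).continuousOn
    · refine tendsto_const_nhds.congr' ((eventually_gt_atTop 2).mono fun β hβ => ?_)
      simp [hχ1 hβ]
    · intro f β hβ
      simp only [Kop, K3, Tn]
      ring

/-- Each `𝒦_{n,i}` is a compact operator on `𝒞^δ_0`: any bounded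
sequence has a subsequence whose images converge in `𝒞^δ`-norm to an element of
`𝒞^δ_0`. -/
theorem stmt_17 (μ δ : ℝ) (hμ : 1 < μ)
    (hδ0 : 0 < δ)
    (hδ1 : δ < min (Real.sqrt (4 * μ ^ 2 - 2 * μ + 1) - 2 * μ + 1) 1)
    (η : ℝ → ℝ) (hη_smooth : ContDiff ℝ (⊤ : ℕ∞) η)
    (hη_range : ∀ β, 0 ≤ η β ∧ η β ≤ 1)
    (hη0 : ∀ β : ℝ, β ≤ 1 → η β = 0) (hη1 : ∀ β : ℝ, 2 ≤ β → η β = 1) :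
    ∀ n : ℤ, n ≠ 0 → ∀ i : Fin 3, ∀ f : ℕ → ℝ → ℂ,
      (∀ k : ℕ, MemCdelta δ (f k) 0 ∧ normC δ (f k) 0 ≤ 1) →
      ∃ φ : ℕ → ℕ, StrictMono φ ∧ ∃ g : ℝ → ℂ, MemCdelta δ g 0 ∧
        Tendsto (fun j : ℕ => normC δ (fun β => Kop μ η n i (f (φ j)) β - g β) 0)
          atTop (nhds 0) := by
  intro n hn i f hf
  obtain ⟨B, C, hBC⟩ := exists_bound_primitive_Lminus hμ hδ0 (hδ1.trans_le (min_le_left _ _))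
    hη_smooth.continuous hη_range hn
  obtain ⟨m, l, hm, hml, hK⟩ :=
    exists_Kop_eq_mul_primitive hμ hη_smooth (fun β => (hη_range β).2) hη0 hη1 hn i
  exact exists_subseq_tendsto_normC hδ0 (hδ1.trans_le (min_le_right _ _)) hm hml
    (T := fun k β => ∫ b in (0 : ℝ)..β, Lminus μ η n (f k) b) (F := fun k => Kop μ η n i (f k))
    (fun k => (hBC (f k) (hf k).1 (hf k).2).1) (fun k => (hBC (f k) (hf k).1 (hf k).2).2)
    fun k => hK (f k)
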